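/- Let P be a probability measure on (Ω, 𝓕) such that the probability space (Ω, 𝓕, P) is atomless, and let H : B_b → ℝ be a law-invariant premium principle (with C = B_b). Then R_Max is law-invariant: R_Max(X) = R_Max(Y) for all X, Y ∈ B_b whose distributions under P coincide. -/

import Mathlib

open MeasureTheory

/-- The set of bounded measurable functions `Ω → ℝ`. -/
def Bb (Ω : Type*) [MeasurableSpace Ω] : Set (Ω → ℝ) :=
  {X | Measurable X ∧ ∃ c : ℝ, ∀ ω, |X ω| ≤ c}

/-- `H` is a premium principle on `C`: (P1) cash additivity and
(P2) `H 0 = 0` and nonnegativity on nonnegative claims. -/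
def IsPremium {Ω : Type*} (C : Set (Ω → ℝ)) (H : (Ω → ℝ) → ℝ) : Prop :=
  (∀ X ∈ C, ∀ m : ℝ, H (fun ω => X ω + m) = H X + m) ∧
  H (fun _ => 0) = 0 ∧
  ∀ X ∈ C, (∀ ω, 0 ≤ X ω) → 0 ≤ H X

/-- `R` is a (monetary) risk measure on `B_b`. -/
def IsRisk {Ω : Type*} [MeasurableSpace Ω] (R : (Ω → ℝ) → ℝ) : Prop :=
  (∀ X ∈ Bb Ω, ∀ m : ℝ, R (fun ω => X ω + m) = R X + m) ∧
  R (fun _ => 0) = 0 ∧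
  ∀ X ∈ Bb Ω, ∀ Y ∈ Bb Ω, (∀ ω, X ω ≤ Y ω) → R X ≤ R Y

/-- `D` is a deviation measure on `C`. -/
def IsDeviation {Ω : Type*} (C : Set (Ω → ℝ)) (D : (Ω → ℝ) → ℝ) : Prop :=
  (∀ X ∈ C, ∀ m : ℝ, D (fun ω => X ω + m) = D X) ∧
  D (fun _ => 0) = 0 ∧
  ∀ X ∈ C, 0 ≤ D X

/-- The maximal risk measure `R_Max(X) = inf {H X₀ | X₀ ∈ C, X₀ ≥ X}`. -/
noncomputable def RMax {Ω : Type*} (C : Set (Ω → ℝ)) (H : (Ω → ℝ) → ℝ) (X : Ω → ℝ) : ℝ :=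
  sInf {y | ∃ X₀ ∈ C, (∀ ω, X ω ≤ X₀ ω) ∧ H X₀ = y}

/-- The minimal deviation measure `D_Min = H - R_Max`. -/
noncomputable def DMin {Ω : Type*} (C : Set (Ω → ℝ)) (H : (Ω → ℝ) → ℝ) (X : Ω → ℝ) : ℝ :=
  H X - RMax C H X

/-- A normalized positive linear functional on `B_b` (a finitely additive probability). -/
def IsNPLF {Ω : Type*} [MeasurableSpace Ω] (μ : (Ω → ℝ) → ℝ) : Prop :=
  (∀ X ∈ Bb Ω, ∀ Y ∈ Bb Ω, μ (fun ω => X ω + Y ω) = μ X + μ Y) ∧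
  (∀ X ∈ Bb Ω, ∀ c : ℝ, μ (fun ω => c * X ω) = c * μ X) ∧
  (∀ X ∈ Bb Ω, (∀ ω, 0 ≤ X ω) → 0 ≤ μ X) ∧
  μ (fun _ => 1) = 1

/-- The convex dual `H*(μ) = sup_{X ∈ C} (μ X - H X)`, valued in `EReal`. -/
noncomputable def Hstar {Ω : Type*} (C : Set (Ω → ℝ)) (H : (Ω → ℝ) → ℝ)
    (μ : (Ω → ℝ) → ℝ) : EReal :=
  ⨆ X ∈ C, ((μ X - H X : ℝ) : EReal)

/-- `H` is convex on `C`. -/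
def IsConvexOn {Ω : Type*} (C : Set (Ω → ℝ)) (H : (Ω → ℝ) → ℝ) : Prop :=
  ∀ X ∈ C, ∀ Y ∈ C, ∀ l : ℝ, 0 ≤ l → l ≤ 1 →
    H (fun ω => l * X ω + (1 - l) * Y ω) ≤ l * H X + (1 - l) * H Y

section AtomlessChain

variable {Ω : Type*} [MeasurableSpace Ω] {P : Measure Ω}

/-- `C` consists of measurable sets, is totally preordered by almost sure inclusion, and is
maximal with this property. -/
structure IsMaxAEChain (P : Measure Ω) (C : Set (Set Ω)) : Prop where
  measurableSet : ∀ A ∈ C, MeasurableSet A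
  total : ∀ A ∈ C, ∀ B ∈ C, A ≤ᵐ[P] B ∨ B ≤ᵐ[P] A
  mem : ∀ E, MeasurableSet E → (∀ D ∈ C, D ≤ᵐ[P] E ∨ E ≤ᵐ[P] D) → E ∈ C

theorem exists_isMaxAEChain (c : Set (Set Ω)) (hm : ∀ A ∈ c, MeasurableSet A)
    (hc : ∀ A ∈ c, ∀ B ∈ c, A ⊆ B ∨ B ⊆ A) : ∃ C, IsMaxAEChain P C ∧ c ⊆ C := by
  let r : {A : Set Ω // MeasurableSet A} → {A : Set Ω // MeasurableSet A} → Prop :=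
    fun A B => A.1 ≤ᵐ[P] B.1
  have hchain : IsChain r {A | A.1 ∈ c} := by
    intro A hA B hB _
    exact (hc _ hA _ hB).imp (fun h => h.eventuallyLE) fun h => h.eventuallyLE
  obtain ⟨M, hM, hcM⟩ := hchain.exists_maxChain
  refine ⟨(fun A => A.1) '' M, ⟨?_, ?_, ?_⟩, ?_⟩
  · rintro _ ⟨A, -, rfl⟩
    exact A.2
  · rintro _ ⟨A, hA, rfl⟩ _ ⟨B, hB, rfl⟩
    by_cases h : A = B
    · subst h
      exact Or.inl (Filter.EventuallyLE.refl _ _)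
    · exact hM.1 hA hB h
  · intro E hE h
    refine ⟨⟨E, hE⟩, ?_, rfl⟩
    have hins : IsChain r (insert ⟨E, hE⟩ M) :=
      hM.1.insert fun D hD _ => (h D.1 ⟨D, hD, rfl⟩).symm
    rw [hM.2 hins (Set.subset_insert _ _)]
    exact Set.mem_insert _ _
  · intro A hA
    exact ⟨⟨A, hm A hA⟩, hcM hA, rfl⟩

namespace IsMaxAEChain

variable {C : Set (Set Ω)}

theorem ae_le_of_measure_le [IsFiniteMeasure P] (hC : IsMaxAEChain P C) {A B : Set Ω}
    (hA : A ∈ C) (hB : B ∈ C) (h : P A ≤ P B) : A ≤ᵐ[P] B := by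
  rcases hC.total A hA B hB with h1 | h1
  · exact h1
  · exact (ae_eq_of_ae_subset_of_measure_ge h1 h
      (hC.measurableSet B hB).nullMeasurableSet (measure_ne_top _ _)).symm.le

theorem compl (hC : IsMaxAEChain P C) : IsMaxAEChain P {A | Aᶜ ∈ C} where
  measurableSet A hA := (hC.measurableSet _ hA).of_compl
  total A hA B hB := by
    rcases hC.total _ hA _ hB with h | h
    · exact Or.inr (by simpa using Filter.EventuallyLE.compl h)
    · exact Or.inl (by simpa using Filter.EventuallyLE.compl h)
  mem E hE h := by
    refine hC.mem _ hE.compl fun D hD => ?_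
    rcases h Dᶜ (by simpa using hD) with h | h
    · exact Or.inr (by simpa using Filter.EventuallyLE.compl h)
    · exact Or.inl (by simpa using Filter.EventuallyLE.compl h)

theorem exists_greatest_below [IsFiniteMeasure P] (hC : IsMaxAEChain P C) (r : ENNReal) :
    ∃ L ∈ C, P L ≤ r ∧ ∀ D ∈ C, P D ≤ r → P D ≤ P L := by
  have hempty : ∅ ∈ C := hC.mem ∅ MeasurableSet.empty
    fun D _ => Or.inr (Set.empty_subset D).eventuallyLE
  let S : Set ENNReal := {x | ∃ A ∈ C, P A ≤ r ∧ P A = x}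
  have hS : S.Nonempty := ⟨_, ∅, hempty, by simp, rfl⟩
  obtain ⟨u, hu, hlim, huS⟩ := exists_seq_tendsto_sSup hS (OrderTop.bddAbove S)
  choose A hAC hAr hAu using huS
  have hle : ∀ m n, m ≤ n → A m ≤ᵐ[P] A n := fun m n h =>
    hC.ae_le_of_measure_le (hAC m) (hAC n) (by rw [hAu, hAu]; exact hu h)
  refine ⟨⋃ n, A n, hC.mem _ (.iUnion fun n => hC.measurableSet _ (hAC n)) ?_, ?_, ?_⟩
  · intro D hD
    by_cases h : ∃ n, D ≤ᵐ[P] A n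
    · obtain ⟨n, hn⟩ := h
      exact Or.inl (hn.trans (Set.subset_iUnion A n).eventuallyLE)
    · push Not at h
      have h' : ∀ n, A n ≤ᵐ[P] D := fun n => (hC.total _ hD _ (hAC n)).resolve_left (h n)
      right
      have := Filter.EventuallyLE.countable_iUnion h'
      rwa [Set.iUnion_const] at this
  · rw [measure_iUnion_eq_iSup_accumulate]
    refine iSup_le fun n => le_trans (measure_mono_ae ?_) (hAr n)
    have h : ∀ᵐ ω ∂P, ∀ m, m ≤ n → ω ∈ A m → ω ∈ A n :=
      ae_all_iff.2 fun m => by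
        by_cases hmn : m ≤ n
        · filter_upwards [hle m n hmn] with ω hω _ using hω
        · exact .of_forall fun ω h => absurd h hmn
    filter_upwards [h] with ω hω hmem
    obtain ⟨m, hm, hmA⟩ := Set.mem_accumulate.1 hmem
    exact hω m hm hmA
  · intro D hD hDr
    have hDS : P D ∈ S := ⟨D, hD, hDr, rfl⟩
    refine (le_sSup hDS).trans (le_of_tendsto' hlim fun n => ?_)
    rw [← hAu]
    exact measure_mono (Set.subset_iUnion A n)

theorem exists_measure_eq [IsProbabilityMeasure P] (hC : IsMaxAEChain P C)
    (hatomless : ∀ A : Set Ω, MeasurableSet A → 0 < P A →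
      ∃ B : Set Ω, MeasurableSet B ∧ B ⊆ A ∧ 0 < P B ∧ P B < P A)
    {r : ENNReal} (hr : r ≤ 1) : ∃ A ∈ C, P A = r := by
  obtain ⟨L, hLC, hLr, hL⟩ := hC.exists_greatest_below r
  obtain ⟨K, hKC, hKr, hK⟩ := hC.compl.exists_greatest_below (1 - r)
  have hLm := hC.measurableSet _ hLC
  have hKm := hC.compl.measurableSet _ hKC
  have hRr : r ≤ P Kᶜ := by
    rw [prob_compl_eq_one_sub hKm, ← ENNReal.sub_sub_cancel ENNReal.one_ne_top hr]
    exact tsub_le_tsub_left hKr 1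
  have hR : ∀ D ∈ C, r ≤ P D → P Kᶜ ≤ P D := by
    intro D hD hDr
    have hDm := hC.measurableSet _ hD
    have h := hK Dᶜ (by simpa using hD)
      (by rw [prob_compl_eq_one_sub hDm]; exact tsub_le_tsub_left hDr 1)
    have h2 := tsub_le_tsub_left h 1
    rwa [← prob_compl_eq_one_sub hKm, ← prob_compl_eq_one_sub hDm.compl, compl_compl] at h2
  by_contra! hne
  have hlt : P L < P Kᶜ := (lt_of_le_of_ne hLr (hne L hLC)).trans_le hRr
  have hLK : L ≤ᵐ[P] Kᶜ := hC.ae_le_of_measure_le hLC hKC hlt.le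
  have hsplit : P L + P (Kᶜ \ L) = P Kᶜ := by
    rw [← measure_inter_add_sdiff Kᶜ hLm]
    congr 1
    refine measure_congr ?_
    filter_upwards [hLK] with ω hω
    exact propext ⟨fun h => ⟨hω h, h⟩, fun h => h.2⟩
  have hpos : 0 < P (Kᶜ \ L) := by
    rw [pos_iff_ne_zero]
    intro h0
    rw [h0, add_zero] at hsplit
    exact hlt.ne hsplit
  obtain ⟨B, hBm, hBs, hB0, hBlt⟩ := hatomless _ (hKm.compl.diff hLm) hpos
  have hPE : P (L ∪ B) = P L + P B :=
    measure_union (Set.disjoint_left.2 fun ω h1 h2 => (hBs h2).2 h1) hBm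
  have hEK : (L ∪ B : Set Ω) ≤ᵐ[P] Kᶜ := by
    filter_upwards [hLK] with ω hω h
    exact h.elim hω fun h => (hBs h).1
  have hEC : L ∪ B ∈ C := by
    refine hC.mem _ (hLm.union hBm) fun D hD => ?_
    rcases le_total (P D) r with h | h
    · exact Or.inl ((hC.ae_le_of_measure_le hD hLC (hL D hD h)).trans
        Set.subset_union_left.eventuallyLE)
    · exact Or.inr (hEK.trans (hC.ae_le_of_measure_le hKC hD (hR D hD h)))
  rcases le_total (P (L ∪ B)) r with h | h
  · have h1 := hL _ hEC h
    rw [hPE] at h1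
    exact absurd h1 (not_le.2 (ENNReal.lt_add_right (measure_ne_top _ _) hB0.ne'))
  · have h1 := hR _ hEC h
    rw [hPE, ← hsplit] at h1
    exact absurd h1 (not_le.2 (ENNReal.add_lt_add_left (measure_ne_top _ _) hBlt))

end IsMaxAEChain

/-- On an atomless probability space, if `Y` has the law of some `X ≤ X₀`, then there is
`Y₀ ≥ Y` with the law of `X₀`. -/
theorem exists_dominating_same_law [IsProbabilityMeasure P]
    (hatomless : ∀ A : Set Ω, MeasurableSet A → 0 < P A →
      ∃ B : Set Ω, MeasurableSet B ∧ B ⊆ A ∧ 0 < P B ∧ P B < P A)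
    {X Y X₀ : Ω → ℝ} (hX : Measurable X) (hY : Y ∈ Bb Ω) (hX₀ : X₀ ∈ Bb Ω)
    (hlaw : P.map X = P.map Y) (hXX₀ : ∀ ω, X ω ≤ X₀ ω) :
    ∃ Y₀ ∈ Bb Ω, (∀ ω, Y ω ≤ Y₀ ω) ∧ P.map X₀ = P.map Y₀ := by
  obtain ⟨hYm, a, ha⟩ := hY
  obtain ⟨hX₀m, b, hb⟩ := hX₀
  obtain ⟨c, hac, hbc⟩ : ∃ c : ℚ, a ≤ c ∧ b ≤ c := by
    obtain ⟨n, hn⟩ := exists_nat_ge (max a b)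
    exact ⟨n, by simpa using (le_max_left a b).trans hn, by simpa using (le_max_right a b).trans hn⟩
  obtain ⟨C, hC, hYC⟩ := exists_isMaxAEChain (P := P) (Set.range fun t : ℝ => Y ⁻¹' Set.Iic t)
    (by rintro _ ⟨t, rfl⟩; exact hYm measurableSet_Iic)
    (by
      rintro _ ⟨s, rfl⟩ _ ⟨t, rfl⟩
      exact (le_total s t).imp (fun h => Set.preimage_mono (Set.Iic_subset_Iic.2 h))
        fun h => Set.preimage_mono (Set.Iic_subset_Iic.2 h))
  choose A hAC hPA using fun q : ℚ =>
    hC.exists_measure_eq hatomless (prob_le_one (μ := P) (s := X₀ ⁻¹' Set.Iic (q : ℝ)))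
  have hAY : ∀ q : ℚ, A q ≤ᵐ[P] Y ⁻¹' Set.Iic (q : ℝ) := by
    intro q
    refine hC.ae_le_of_measure_le (hAC q) (hYC ⟨_, rfl⟩) ?_
    rw [hPA, ← Measure.map_apply hYm measurableSet_Iic, ← hlaw,
      Measure.map_apply hX measurableSet_Iic]
    exact measure_mono fun ω hω => (hXX₀ ω).trans hω
  have hYle : ∀ ω, Y ω ≤ c := fun ω => (abs_le.1 (ha ω)).2.trans hac
  have hX₀le : ∀ ω, X₀ ω ≤ c := fun ω => (abs_le.1 (hb ω)).2.trans hbc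
  let B : ℚ → Set Ω := fun q => {ω | c ≤ q} ∪ (A q ∩ Y ⁻¹' Set.Iic (q : ℝ))
  have hBm : ∀ q, MeasurableSet (B q) := fun q =>
    (MeasurableSet.const _).union ((hC.measurableSet _ (hAC q)).inter (hYm measurableSet_Iic))
  have hBY : ∀ q, ∀ ω ∈ B q, Y ω ≤ q := by
    rintro q ω (h | h)
    · exact (hYle ω).trans (by exact_mod_cast h)
    · exact h.2
  have hBA : ∀ q, B q =ᵐ[P] A q := by
    intro q
    by_cases hq : c ≤ q
    · have hone : P (A q) = 1 := by
        have huniv : X₀ ⁻¹' Set.Iic (q : ℝ) = Set.univ :=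
          Set.eq_univ_of_forall fun ω => (hX₀le ω).trans (by exact_mod_cast hq)
        rw [hPA, huniv, measure_univ]
      have hmem : ∀ᵐ ω ∂P, ω ∈ A q :=
        (prob_compl_eq_zero_iff (hC.measurableSet _ (hAC q))).2 hone
      filter_upwards [hmem] with ω hω
      exact propext ⟨fun _ => hω, fun _ => Or.inl hq⟩
    · filter_upwards [hAY q] with ω hω
      exact propext ⟨fun h => (h.resolve_left hq).1, fun h => Or.inr ⟨h, hω h⟩⟩
  let S : Ω → Set ℝ := fun ω => {x | ∃ q : ℚ, ω ∈ B q ∧ (q : ℝ) = x}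
  have hcS : ∀ ω, (c : ℝ) ∈ S ω := fun ω => ⟨c, Or.inl (le_refl c), rfl⟩
  have hYlb : ∀ ω, Y ω ∈ lowerBounds (S ω) := by
    rintro ω _ ⟨q, hq, rfl⟩
    exact hBY q ω hq
  let Y₀ : Ω → ℝ := fun ω => sInf (S ω)
  have hYY₀ : ∀ ω, Y ω ≤ Y₀ ω := fun ω => le_csInf ⟨_, hcS ω⟩ (hYlb ω)
  have hY₀c : ∀ ω, Y₀ ω ≤ c := fun ω => csInf_le ⟨_, hYlb ω⟩ (hcS ω)
  have hIio : ∀ t : ℝ, Y₀ ⁻¹' Set.Iio t = ⋃ q : {q : ℚ // (q : ℝ) < t}, B q := by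
    intro t
    ext ω
    simp only [Set.mem_preimage, Set.mem_Iio, Set.mem_iUnion]
    constructor
    · intro h
      obtain ⟨_, ⟨q, hq, rfl⟩, hqt⟩ := exists_lt_of_csInf_lt ⟨_, hcS ω⟩ h
      exact ⟨⟨q, hqt⟩, hq⟩
    · rintro ⟨⟨q, hqt⟩, hq⟩
      exact (csInf_le ⟨_, hYlb ω⟩ ⟨q, hq, rfl⟩).trans_lt hqt
  have hY₀m : Measurable Y₀ := measurable_of_Iio fun t => by
    rw [hIio]
    exact .iUnion fun q => hBm q
  refine ⟨Y₀, ⟨hY₀m, c, fun ω => abs_le.2 ⟨?_, hY₀c ω⟩⟩, hYY₀, ?_⟩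
  · linarith [(abs_le.1 (ha ω)).1, hYY₀ ω]
  have hmeas : ∀ t : ℝ, P (X₀ ⁻¹' Set.Iio t) = P (Y₀ ⁻¹' Set.Iio t) := by
    intro t
    rw [hIio]
    apply le_antisymm
    · have hunion : X₀ ⁻¹' Set.Iio t =
          ⋃ q : {q : ℚ // (q : ℝ) < t}, X₀ ⁻¹' Set.Iic (q : ℝ) := by
        ext ω
        simp only [Set.mem_preimage, Set.mem_Iio, Set.mem_iUnion, Set.mem_Iic]
        constructor
        · intro h
          obtain ⟨q, h1, h2⟩ := exists_rat_btwn h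
          exact ⟨⟨q, h2⟩, h1.le⟩
        · rintro ⟨⟨q, hqt⟩, hq⟩
          exact lt_of_le_of_lt hq hqt
      have hmono : Monotone fun q : {q : ℚ // (q : ℝ) < t} => X₀ ⁻¹' Set.Iic (q : ℝ) :=
        fun p q h => Set.preimage_mono (Set.Iic_subset_Iic.2 (by exact_mod_cast h))
      rw [hunion, hmono.directed_le.measure_iUnion]
      refine iSup_le fun q => ?_
      rw [← hPA, ← measure_congr (hBA q)]
      exact measure_mono (Set.subset_iUnion (fun q : {q : ℚ // (q : ℝ) < t} => B q) q)
    · obtain ⟨E, hEC, hPE⟩ :=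
        hC.exists_measure_eq hatomless (prob_le_one (μ := P) (s := X₀ ⁻¹' Set.Iio t))
      rw [← hPE]
      refine measure_mono_ae ?_
      have h : ∀ q : {q : ℚ // (q : ℝ) < t}, B q ≤ᵐ[P] E := by
        intro q
        refine (hBA q).le.trans (hC.ae_le_of_measure_le (hAC q) hEC ?_)
        rw [hPA, hPE]
        exact measure_mono fun ω hω => lt_of_le_of_lt hω q.2
      filter_upwards [ae_all_iff.2 h] with ω hω hmem
      obtain ⟨q, hq⟩ := Set.mem_iUnion.1 hmem
      exact hω q hq
  have := Measure.isProbabilityMeasure_map (μ := P) hX₀m.aemeasurable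
  refine Measure.ext_of_Ici _ _ fun t => ?_
  rw [Measure.map_apply hX₀m measurableSet_Ici, Measure.map_apply hY₀m measurableSet_Ici,
    ← Set.compl_Iio, Set.preimage_compl, Set.preimage_compl,
    prob_compl_eq_one_sub (hX₀m measurableSet_Iio),
    prob_compl_eq_one_sub (hY₀m measurableSet_Iio), hmeas]

end AtomlessChain

/-- on an atomless probability space, if a premium principle on
`B_b` is law-invariant, then `R_Max` is law-invariant. -/
theorem RMax_law_invariant {Ω : Type*} [MeasurableSpace Ω]
    (P : Measure Ω) [IsProbabilityMeasure P]
    (hatomless : ∀ A : Set Ω, MeasurableSet A → 0 < P A →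
      ∃ B : Set Ω, MeasurableSet B ∧ B ⊆ A ∧ 0 < P B ∧ P B < P A)
    (H : (Ω → ℝ) → ℝ) (hH : IsPremium (Bb Ω) H)
    (hlaw : ∀ X ∈ Bb Ω, ∀ Y ∈ Bb Ω, P.map X = P.map Y → H X = H Y) :
    ∀ X ∈ Bb Ω, ∀ Y ∈ Bb Ω, P.map X = P.map Y →
      RMax (Bb Ω) H X = RMax (Bb Ω) H Y := by
  have hset : ∀ X ∈ Bb Ω, ∀ Y ∈ Bb Ω, P.map X = P.map Y →
      {y | ∃ X₀ ∈ Bb Ω, (∀ ω, X ω ≤ X₀ ω) ∧ H X₀ = y} ⊆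
        {y | ∃ Y₀ ∈ Bb Ω, (∀ ω, Y ω ≤ Y₀ ω) ∧ H Y₀ = y} := by
    rintro X hX Y hY hXY _ ⟨X₀, hX₀, hle, rfl⟩
    obtain ⟨Y₀, hY₀, hYY₀, hmap⟩ :=
      exists_dominating_same_law hatomless hX.1 hY hX₀ hXY hle
    exact ⟨Y₀, hY₀, hYY₀, (hlaw _ hX₀ _ hY₀ hmap).symm⟩
  intro X hX Y hY hXY
  exact congrArg sInf ((hset X hX Y hY hXY).antisymm (hset Y hY X hX hXY.symm))
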